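/- Let 0 < γ ≤ α. For every t > 0, ∫_{ℚ_p⁴} (f(∂,γ)Z_t)(x) d⁴x = 0. -/

import Mathlib

open MeasureTheory Real Filter Set

noncomputable section

namespace PadicParabolic

variable (p : ℕ) [Fact p.Prime]

instance : MeasurableSpace ℚ_[p] := borel _
instance : BorelSpace ℚ_[p] := ⟨rfl⟩

/-- The four dimensional vector space over `ℚ_[p]`, with the max-norm
`‖x‖ = max_{1 ≤ i ≤ 4} |x_i|_p`. -/
abbrev V (p : ℕ) [Fact p.Prime] := Fin 4 → ℚ_[p]

/-- `a` is a quadratic non-residue modulo `p`. -/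
def IsQNR (a : ℤ) : Prop := ∀ b : ZMod p, b ^ 2 ≠ (a : ZMod p)

/-- The elliptic quadratic form `f(x) = x₁² − a x₂² − p x₃² + a p x₄²`. -/
def qf (a : ℤ) (x : V p) : ℚ_[p] :=
  x 0 ^ 2 - (a : ℚ_[p]) * x 1 ^ 2 - (p : ℚ_[p]) * x 2 ^ 2 + (a : ℚ_[p]) * (p : ℚ_[p]) * x 3 ^ 2

/-- The dual elliptic quadratic form `f°(ξ) = a p ξ₁² − p ξ₂² − a ξ₃² + ξ₄²`. -/
def qfc (a : ℤ) (x : V p) : ℚ_[p] :=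
  (a : ℚ_[p]) * (p : ℚ_[p]) * x 0 ^ 2 - (p : ℚ_[p]) * x 1 ^ 2 - (a : ℚ_[p]) * x 2 ^ 2 + x 3 ^ 2

/-- `χ` is the standard additive character `χ(y) = exp(2πi {y}_p)` of `ℚ_p`, characterized as
the unique continuous function with `χ(m/pⁿ) = exp(2πi m/pⁿ)`. -/
def IsStdChar (χ : ℚ_[p] → ℂ) : Prop :=
  Continuous χ ∧ ∀ (m : ℤ) (n : ℕ),
    χ ((m : ℚ_[p]) / (p : ℚ_[p]) ^ n) =
      Complex.exp (2 * (Real.pi : ℂ) * Complex.I * (m : ℂ) / (p : ℂ) ^ n)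

/-- The heat kernel `Z(x,t) = ∫_{ℚ_p⁴} χ(ξ·x) e^{−κ t |f°(ξ)|_p^α} d⁴ξ`. -/
def heatZ (μ : Measure (V p)) (χ : ℚ_[p] → ℂ) (a : ℤ) (κ α : ℝ) (x : V p) (t : ℝ) : ℂ :=
  ∫ ξ, χ (∑ i, ξ i * x i) * (Real.exp (-(κ * t * ‖qfc p a ξ‖ ^ α)) : ℂ) ∂μ

/-- The pseudodifferential operator
`(f(∂,γ)φ)(x) = ((1 − p^γ)/(1 − p^{−γ−2})) ∫ (φ(x−y) − φ(x)) |f(y)|_p^{−γ−2} d⁴y`. -/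
def fop (μ : Measure (V p)) (a : ℤ) (γ : ℝ) (φ : V p → ℂ) (x : V p) : ℂ :=
  (((1 - (p : ℝ) ^ γ) / (1 - (p : ℝ) ^ (-γ - 2)) : ℝ) : ℂ) *
    ∫ y, (φ (x - y) - φ x) * ((‖qf p a y‖ ^ (-γ - 2) : ℝ) : ℂ) ∂μ

/-- Membership in the domain of `f(∂,γ)`: `φ` is locally constant and
`∫_{‖x‖_p ≥ p^m} |φ(x)| |f(x)|_p^{−γ−2} d⁴x < ∞` for some `m ∈ ℤ`. -/
def InDomain (μ : Measure (V p)) (a : ℤ) (γ : ℝ) (φ : V p → ℂ) : Prop :=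
  IsLocallyConstant φ ∧ ∃ m : ℤ,
    IntegrableOn (fun x => ‖φ x‖ * ‖qf p a x‖ ^ (-γ - 2)) {x : V p | (p : ℝ) ^ m ≤ ‖x‖} μ

section Norms

variable {p}

lemma one_lt_cast : (1 : ℝ) < p := by
  exact_mod_cast (Fact.out : p.Prime).one_lt

lemma cast_pos : (0 : ℝ) < p := zero_lt_one.trans one_lt_cast

lemma norm_intCast_eq_one_of_isQNR {a : ℤ} (ha : IsQNR p a) : ‖(a : ℚ_[p])‖ = 1 := by
  refine le_antisymm (Padic.norm_int_le_one a) (not_lt.1 fun h => ha 0 ?_)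
  rw [Padic.norm_intCast_lt_one_iff] at h
  simp [(ZMod.intCast_zmod_eq_zero_iff_dvd a p).2 h]

lemma norm_sq_sub_intCast_mul_sq {a : ℤ} (ha : IsQNR p a) (u v : ℚ_[p]) :
    ‖u ^ 2 - a * v ^ 2‖ = max (‖u‖ ^ 2) (‖v‖ ^ 2) := by
  have ha1 := norm_intCast_eq_one_of_isQNR ha
  rcases lt_or_ge ‖v‖ ‖u‖ with h | h
  · have h2 : ‖v‖ ^ 2 < ‖u‖ ^ 2 := by gcongr
    rw [sub_eq_add_neg, Padic.add_eq_max_of_ne] <;> simp [ha1, h2.ne']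
  · have h2 : ‖u‖ ^ 2 ≤ ‖v‖ ^ 2 := by gcongr
    rw [max_eq_right h2]
    rcases eq_or_ne v 0 with rfl | hv
    · simp_all
    have hw : ‖u / v‖ ≤ 1 := by
      rw [norm_div]
      exact div_le_one_of_le₀ h (norm_nonneg _)
    obtain ⟨w, hw⟩ : ∃ w : ℤ_[p], (w : ℚ_[p]) = u / v := ⟨⟨u / v, hw⟩, rfl⟩
    have key : ‖w ^ 2 - (a : ℤ_[p])‖ = 1 := by
      refine le_antisymm (PadicInt.norm_le_one _) (not_lt.1 fun hlt => ?_)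
      apply ha (PadicInt.toZMod w)
      have hmem : w ^ 2 - (a : ℤ_[p]) ∈ RingHom.ker PadicInt.toZMod := by
        rw [PadicInt.ker_toZMod, PadicInt.maximalIdeal_eq_span_p,
          Ideal.mem_span_singleton, ← PadicInt.norm_lt_one_iff_dvd]
        exact hlt
      rw [RingHom.mem_ker, map_sub, map_pow, map_intCast, sub_eq_zero] at hmem
      exact hmem
    have key' : ‖(u / v) ^ 2 - (a : ℚ_[p])‖ = 1 := by
      rw [← key, PadicInt.norm_def, ← hw]
      push_cast
      rfl
    have : u ^ 2 - a * v ^ 2 = ((u / v) ^ 2 - a) * v ^ 2 := by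
      field_simp
    rw [this, norm_mul, key', one_mul, norm_pow]

lemma norm_sq_ne_norm_sq_div (u v : ℚ_[p]) (hv : v ≠ 0) : ‖u‖ ^ 2 ≠ ‖v‖ ^ 2 / p := by
  intro h
  have hp := cast_pos (p := p)
  have hu : u ≠ 0 := by
    rintro rfl
    have : 0 < ‖v‖ ^ 2 / p := by positivity
    simp at h
    simp_all
  rw [Padic.norm_eq_zpow_neg_valuation hu, Padic.norm_eq_zpow_neg_valuation hv,
    ← zpow_natCast, ← zpow_natCast, ← zpow_mul, ← zpow_mul, div_eq_mul_inv,
    ← zpow_sub_one₀ hp.ne'] at h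
  have := zpow_right_injective₀ hp one_lt_cast.ne' h
  omega

lemma norm_qf {a : ℤ} (ha : IsQNR p a) (x : V p) :
    ‖qf p a x‖ = max (max (‖x 0‖ ^ 2) (‖x 1‖ ^ 2)) (max (‖x 2‖ ^ 2) (‖x 3‖ ^ 2) / p) := by
  have h1 := norm_sq_sub_intCast_mul_sq ha (x 0) (x 1)
  have h2 := norm_sq_sub_intCast_mul_sq ha (x 2) (x 3)
  have h3 : ‖-((p : ℚ_[p]) * (x 2 ^ 2 - a * x 3 ^ 2))‖ = max (‖x 2‖ ^ 2) (‖x 3‖ ^ 2) / p := by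
    rw [norm_neg, norm_mul, h2, Padic.norm_p]
    ring
  have hq : qf p a x = (x 0 ^ 2 - a * x 1 ^ 2) + -((p : ℚ_[p]) * (x 2 ^ 2 - a * x 3 ^ 2)) := by
    unfold qf
    ring
  rw [hq, ← h1, ← h3]
  by_cases hv : x 2 = 0 ∧ x 3 = 0
  · simp [hv]
  refine Padic.add_eq_max_of_ne ?_
  rw [h1, h3]
  obtain ⟨u, hu⟩ : ∃ u, max (‖x 0‖ ^ 2) (‖x 1‖ ^ 2) = ‖u‖ ^ 2 := by
    rcases max_choice (‖x 0‖ ^ 2) (‖x 1‖ ^ 2) with h | h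
    exacts [⟨_, h⟩, ⟨_, h⟩]
  obtain ⟨v, hv'⟩ : ∃ v, max (‖x 2‖ ^ 2) (‖x 3‖ ^ 2) = ‖v‖ ^ 2 := by
    rcases max_choice (‖x 2‖ ^ 2) (‖x 3‖ ^ 2) with h | h
    exacts [⟨_, h⟩, ⟨_, h⟩]
  rw [hu, hv']
  refine norm_sq_ne_norm_sq_div u v fun hv0 => hv ?_
  rw [hv0, norm_zero, zero_pow two_ne_zero] at hv'
  have h2' : ‖x 2‖ ^ 2 ≤ 0 := hv' ▸ le_max_left _ _
  have h3' : ‖x 3‖ ^ 2 ≤ 0 := hv' ▸ le_max_right _ _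
  simpa using And.intro (pow_eq_zero_iff two_ne_zero |>.1 (h2'.antisymm (by positivity)))
    (pow_eq_zero_iff two_ne_zero |>.1 (h3'.antisymm (by positivity)))

lemma norm_sq_le_mul_norm_qf {a : ℤ} (ha : IsQNR p a) (x : V p) :
    ‖x‖ ^ 2 ≤ p * ‖qf p a x‖ := by
  have hp := cast_pos (p := p)
  have h1 := one_lt_cast (p := p)
  have hx : ∀ i, ‖x i‖ ^ 2 ≤ p * ‖qf p a x‖ := by
    have hl : ∀ s : ℝ, 0 ≤ s → s ≤ ‖qf p a x‖ → s ≤ p * ‖qf p a x‖ := fun s hs h => by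
      nlinarith
    have hr : ∀ s : ℝ, s / p ≤ ‖qf p a x‖ → s ≤ p * ‖qf p a x‖ := fun s h => by
      rwa [div_le_iff₀' hp] at h
    rw [norm_qf ha] at *
    intro i
    fin_cases i
    · exact hl _ (by positivity) (by simp)
    · exact hl _ (by positivity) (by simp)
    · exact hr _ (le_max_of_le_right (by gcongr; exact le_max_left _ _))
    · exact hr _ (le_max_of_le_right (by gcongr; exact le_max_right _ _))
  rw [← Real.le_sqrt (norm_nonneg _) (by positivity), pi_norm_le_iff_of_nonneg (Real.sqrt_nonneg _)]
  exact fun i => Real.le_sqrt_of_sq_le (hx i)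

lemma norm_qf_le_norm_sq {a : ℤ} (ha : IsQNR p a) (x : V p) : ‖qf p a x‖ ≤ ‖x‖ ^ 2 := by
  have hx : ∀ i, ‖x i‖ ^ 2 ≤ ‖x‖ ^ 2 := fun i => by
    gcongr
    exact norm_le_pi_norm x i
  rw [norm_qf ha]
  refine max_le (max_le (hx 0) (hx 1)) ?_
  exact (div_le_self (by positivity) one_lt_cast.le).trans (max_le (hx 2) (hx 3))

lemma norm_qf_add_le {a : ℤ} (ha : IsQNR p a) (x y : V p) :
    ‖qf p a (x + y)‖ ≤ max ‖qf p a x‖ ‖qf p a y‖ := by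
  have hp := cast_pos (p := p)
  have h : ∀ i, ‖(x + y) i‖ ^ 2 ≤ max (‖x i‖ ^ 2) (‖y i‖ ^ 2) := fun i => by
    rcases le_max_iff.1 (Padic.nonarchimedean (x i) (y i)) with h | h
    · exact le_max_of_le_left (by gcongr; exact h)
    · exact le_max_of_le_right (by gcongr; exact h)
  simp only [norm_qf ha, ← max_div_div_right hp.le]
  refine max_le (max_le ?_ ?_) (max_le ?_ ?_)
  · exact (h 0).trans (max_le_max (by simp) (by simp))
  · exact (h 1).trans (max_le_max (by simp) (by simp))
  · exact (div_le_div_of_nonneg_right (h 2) hp.le).trans (by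
      rw [← max_div_div_right hp.le]; exact max_le_max (by simp) (by simp))
  · exact (div_le_div_of_nonneg_right (h 3) hp.le).trans (by
      rw [← max_div_div_right hp.le]; exact max_le_max (by simp) (by simp))

lemma qfc_eq_qf_rev (a : ℤ) (x : V p) : qfc p a x = qf p a (x ∘ Fin.rev) := by
  have h0 : Fin.rev (0 : Fin 4) = 3 := rfl
  have h1 : Fin.rev (1 : Fin 4) = 2 := rfl
  have h2 : Fin.rev (2 : Fin 4) = 1 := rfl
  have h3 : Fin.rev (3 : Fin 4) = 0 := rfl
  simp only [qfc, qf, Function.comp, h0, h1, h2, h3]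
  ring

lemma norm_comp_rev (x : V p) : ‖x ∘ Fin.rev‖ = ‖x‖ := by
  refine le_antisymm ?_ ?_ <;> rw [pi_norm_le_iff_of_nonneg (norm_nonneg _)] <;> intro i
  · exact norm_le_pi_norm x i.rev
  · simpa using norm_le_pi_norm (x ∘ Fin.rev) i.rev

lemma norm_sq_le_mul_norm_qfc {a : ℤ} (ha : IsQNR p a) (x : V p) :
    ‖x‖ ^ 2 ≤ p * ‖qfc p a x‖ := by
  rw [qfc_eq_qf_rev, ← norm_comp_rev]
  exact norm_sq_le_mul_norm_qf ha _

lemma norm_qfc_le_norm_sq {a : ℤ} (ha : IsQNR p a) (x : V p) : ‖qfc p a x‖ ≤ ‖x‖ ^ 2 := by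
  rw [qfc_eq_qf_rev, ← norm_comp_rev]
  exact norm_qf_le_norm_sq ha _

lemma norm_qfc_add_le {a : ℤ} (ha : IsQNR p a) (x y : V p) :
    ‖qfc p a (x + y)‖ ≤ max ‖qfc p a x‖ ‖qfc p a y‖ := by
  simp only [qfc_eq_qf_rev]
  exact norm_qf_add_le ha _ _

end Norms

section StandardCharacter

variable {p}

lemma denseRange_intCast_div_pow :
    DenseRange fun q : ℤ × ℕ => (q.1 : ℚ_[p]) / (p : ℚ_[p]) ^ q.2 := by
  have hp : (p : ℚ_[p]) ≠ 0 := by exact_mod_cast (Fact.out : p.Prime).ne_zero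
  intro x
  obtain ⟨n, hn⟩ : ∃ n : ℕ, ‖x‖ ≤ (p : ℝ) ^ n :=
    (pow_unbounded_of_one_lt ‖x‖ one_lt_cast).imp fun _ h => h.le
  have hx : ‖x * (p : ℚ_[p]) ^ n‖ ≤ 1 := by
    rw [norm_mul, norm_pow, Padic.norm_p, inv_pow]
    exact mul_inv_le_one_of_le₀ hn (by positivity)
  have hc : Continuous fun z : ℤ_[p] => (z : ℚ_[p]) / (p : ℚ_[p]) ^ n := by fun_prop
  have hmem := hc.range_subset_closure_image_dense
    (PadicInt.denseRange_intCast (p := p)) ⟨⟨_, hx⟩, rfl⟩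
  rw [← Set.range_comp] at hmem
  have hxe : x * (p : ℚ_[p]) ^ n / (p : ℚ_[p]) ^ n = x := by field_simp
  rw [← hxe]
  refine closure_mono ?_ hmem
  rintro _ ⟨m, rfl⟩
  exact ⟨(m, n), by simp⟩

variable {χ : ℚ_[p] → ℂ}

lemma IsStdChar.map_add (hχ : IsStdChar p χ) (x y : ℚ_[p]) : χ (x + y) = χ x * χ y := by
  have hp : (p : ℚ_[p]) ≠ 0 := by exact_mod_cast (Fact.out : p.Prime).ne_zero
  have hpc : (p : ℂ) ≠ 0 := by exact_mod_cast (Fact.out : p.Prime).ne_zero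
  have hc := hχ.1
  refine denseRange_intCast_div_pow.induction_on₂ (p := fun x y => χ (x + y) = χ x * χ y)
    (isClosed_eq (by fun_prop) (by fun_prop)) (fun q r => ?_) x y
  have h : (q.1 : ℚ_[p]) / (p : ℚ_[p]) ^ q.2 + (r.1 : ℚ_[p]) / (p : ℚ_[p]) ^ r.2 =
      ((q.1 * p ^ r.2 + r.1 * p ^ q.2 : ℤ) : ℚ_[p]) / (p : ℚ_[p]) ^ (q.2 + r.2) := by
    push_cast
    field_simp
    ring
  rw [h, hχ.2, hχ.2, hχ.2, ← Complex.exp_add]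
  congr 1
  push_cast
  field_simp
  ring

lemma IsStdChar.norm_eq_one (hχ : IsStdChar p χ) (x : ℚ_[p]) : ‖χ x‖ = 1 := by
  have hc := hχ.1
  refine denseRange_intCast_div_pow.induction_on (p := fun x => ‖χ x‖ = 1) x
    (isClosed_eq (by fun_prop) (by fun_prop)) fun q => ?_
  have h : (2 * (Real.pi : ℂ) * Complex.I * (q.1 : ℂ) / (p : ℂ) ^ q.2) =
      ((2 * Real.pi * q.1 / p ^ q.2 : ℝ) : ℂ) * Complex.I := by
    push_cast
    ring
  rw [hχ.2, h, Complex.norm_exp_ofReal_mul_I]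

lemma IsStdChar.eq_one_of_norm_le_one (hχ : IsStdChar p χ) {x : ℚ_[p]} (hx : ‖x‖ ≤ 1) :
    χ x = 1 := by
  have hc := hχ.1
  refine PadicInt.denseRange_intCast.induction_on (p := fun z : ℤ_[p] => χ z = 1) ⟨x, hx⟩
    (isClosed_eq (by fun_prop) (by fun_prop)) fun m => ?_
  have := hχ.2 m 0
  rw [pow_zero, pow_zero, div_one, div_one] at this
  rw [PadicInt.coe_intCast, this, Complex.exp_eq_one_iff]
  exact ⟨m, by ring⟩

lemma IsStdChar.inv_prime_ne_one (hχ : IsStdChar p χ) : χ (p : ℚ_[p])⁻¹ ≠ 1 := by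
  have h1 : (p : ℂ) ≠ 0 := by exact_mod_cast (Fact.out : p.Prime).ne_zero
  have := hχ.2 1 1
  rw [Int.cast_one, pow_one, one_div] at this
  rw [this, Ne, Complex.exp_eq_one_iff]
  rintro ⟨n, hn⟩
  have hpi : (2 * (Real.pi : ℂ) * Complex.I) ≠ 0 := Complex.two_pi_I_ne_zero
  have h2 : (n : ℂ) * p = 1 := by
    have : (2 * (Real.pi : ℂ) * Complex.I) * (n * p) = (2 * (Real.pi : ℂ) * Complex.I) * 1 := by
      field_simp at hn ⊢
      push_cast at hn
      linear_combination -hn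
    exact mul_left_cancel₀ hpi this
  have h3 : n * p = 1 := by exact_mod_cast h2
  exact (Nat.prime_iff_prime_int.1 (Fact.out : p.Prime)).not_isUnit (IsUnit.of_mul_eq_one_right n h3)

end StandardCharacter

section Balls

variable {p}

lemma closedBall_zpow_add_one_eq_iUnion (j : ℤ) :
    Metric.closedBall (0 : V p) ((p : ℝ) ^ (j + 1)) =
      ⋃ d : Fin 4 → Fin p, Metric.closedBall (fun i => (p : ℚ_[p]) ^ (-(j + 1)) * ((d i : ℕ) : ℚ_[p]))
        ((p : ℝ) ^ j) := by
  have hp := cast_pos (p := p)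
  have hpq : (p : ℚ_[p]) ≠ 0 := by exact_mod_cast (Fact.out : p.Prime).ne_zero
  have hj : (0 : ℝ) ≤ (p : ℝ) ^ j := by positivity
  have hj1 : (0 : ℝ) ≤ (p : ℝ) ^ (j + 1) := by positivity
  ext x
  simp only [Set.mem_iUnion, mem_closedBall_iff_norm, pi_norm_le_iff_of_nonneg hj,
    pi_norm_le_iff_of_nonneg hj1, Pi.sub_apply, sub_zero]
  constructor
  · intro hx
    have hy : ∀ i, ∃ d : Fin p, ‖x i - (p : ℚ_[p]) ^ (-(j + 1)) * ((d : ℕ) : ℚ_[p])‖ ≤ (p : ℝ) ^ j := by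
      intro i
      have hyi : ‖(p : ℚ_[p]) ^ (j + 1) * x i‖ ≤ 1 := by
        rw [norm_mul, Padic.norm_p_zpow, zpow_neg]
        exact inv_mul_le_one_of_le₀ (hx i) hj1
      obtain ⟨w, hw⟩ : ∃ w : ℤ_[p], (w : ℚ_[p]) = (p : ℚ_[p]) ^ (j + 1) * x i := ⟨⟨_, hyi⟩, rfl⟩
      refine ⟨⟨w.zmodRepr, PadicInt.zmodRepr_lt_p w⟩, ?_⟩
      have hlt := PadicInt.norm_sub_zmodRepr_lt_one w
      rw [PadicInt.norm_lt_one_iff_dvd] at hlt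
      obtain ⟨z, hz⟩ := hlt
      have hz' : (p : ℚ_[p]) ^ (j + 1) * x i - (w.zmodRepr : ℚ_[p]) = p * z := by
        rw [← hw]
        exact_mod_cast congrArg (fun z : ℤ_[p] => (z : ℚ_[p])) hz
      have hxi : x i - (p : ℚ_[p]) ^ (-(j + 1)) * (w.zmodRepr : ℚ_[p]) =
          (p : ℚ_[p]) ^ (-j) * z := by
        rw [eq_add_of_sub_eq hz' |> fun h => (eq_inv_mul_iff_mul_eq₀ (zpow_ne_zero _ hpq)).2 h,
          zpow_neg, zpow_neg, zpow_add_one₀ hpq]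
        field_simp
        ring
      rw [hxi, norm_mul, Padic.norm_p_zpow, neg_neg]
      exact mul_le_of_le_one_right hj (PadicInt.norm_le_one z)
    choose d hd using hy
    exact ⟨d, hd⟩
  · rintro ⟨d, hd⟩ i
    rw [← sub_add_cancel (x i) ((p : ℚ_[p]) ^ (-(j + 1)) * ((d i : ℕ) : ℚ_[p]))]
    refine (Padic.nonarchimedean _ _).trans (max_le ((hd i).trans ?_) ?_)
    · exact zpow_le_zpow_right₀ one_lt_cast.le (by omega)
    · rw [norm_mul, Padic.norm_p_zpow, neg_neg]
      exact mul_le_of_le_one_right hj1 (by simpa using Padic.norm_int_le_one (p := p) (d i : ℕ))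

lemma pairwise_disjoint_closedBall_zpow (j : ℤ) :
    Pairwise (Function.onFun Disjoint fun d : Fin 4 → Fin p =>
      Metric.closedBall (fun i => (p : ℚ_[p]) ^ (-(j + 1)) * ((d i : ℕ) : ℚ_[p]) : V p)
        ((p : ℝ) ^ j)) := by
  have hp := cast_pos (p := p)
  have hj : (0 : ℝ) ≤ (p : ℝ) ^ j := by positivity
  intro d e hde
  refine Set.disjoint_left.2 fun x hd he => hde ?_
  simp only [mem_closedBall_iff_norm, pi_norm_le_iff_of_nonneg hj, Pi.sub_apply] at hd he
  funext i
  have h : ‖(p : ℚ_[p]) ^ (-(j + 1)) * (((d i : ℤ) - (e i : ℤ) : ℤ) : ℚ_[p])‖ ≤ (p : ℝ) ^ j := by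
    have hs : (p : ℚ_[p]) ^ (-(j + 1)) * (((d i : ℤ) - (e i : ℤ) : ℤ) : ℚ_[p]) =
        (x i - (p : ℚ_[p]) ^ (-(j + 1)) * ((e i : ℕ) : ℚ_[p])) +
          -(x i - (p : ℚ_[p]) ^ (-(j + 1)) * ((d i : ℕ) : ℚ_[p])) := by
      push_cast
      ring
    rw [hs]
    refine (Padic.nonarchimedean _ _).trans (max_le (he i) ?_)
    rw [norm_neg]
    exact hd i
  rw [norm_mul, Padic.norm_p_zpow, neg_neg, zpow_add_one₀ hp.ne', mul_assoc] at h
  have h2 : (p : ℝ) * ‖(((d i : ℤ) - (e i : ℤ) : ℤ) : ℚ_[p])‖ ≤ 1 :=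
    le_of_mul_le_mul_left (by simpa using h) (zpow_pos hp j)
  have h3 : ‖(((d i : ℤ) - (e i : ℤ) : ℤ) : ℚ_[p])‖ < 1 := by
    have := one_lt_cast (p := p)
    by_contra! hcon
    nlinarith
  rw [Padic.norm_intCast_lt_one_iff] at h3
  have h4 := Int.eq_zero_of_abs_lt_dvd h3 (by
    have := (d i).isLt
    have := (e i).isLt
    rw [abs_lt]
    constructor <;> omega)
  exact Fin.ext (by omega)

variable (μ : Measure (V p)) [μ.IsAddHaarMeasure]

lemma measure_closedBall_eq (c : V p) (r : ℝ) :
    μ (Metric.closedBall c r) = μ (Metric.closedBall 0 r) := by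
  rw [← measure_preimage_add μ (-c) (Metric.closedBall 0 r)]
  congr 1
  ext x
  simp [neg_add_eq_sub, dist_eq_norm]

lemma measure_closedBall_zpow_add_one (j : ℤ) :
    μ (Metric.closedBall 0 ((p : ℝ) ^ (j + 1))) =
      (p : ENNReal) ^ 4 * μ (Metric.closedBall 0 ((p : ℝ) ^ j)) := by
  rw [closedBall_zpow_add_one_eq_iUnion, measure_iUnion (pairwise_disjoint_closedBall_zpow j)
    fun _ => Metric.isClosed_closedBall.measurableSet]
  simp only [measure_closedBall_eq μ, tsum_fintype, Finset.sum_const, Finset.card_univ,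
    Fintype.card_pi, Fintype.card_fin, Finset.prod_const, nsmul_eq_mul]
  push_cast
  rfl

lemma measure_closedBall_zpow (hμ : μ {x : V p | ‖x‖ ≤ 1} = 1) (j : ℤ) :
    μ (Metric.closedBall 0 ((p : ℝ) ^ j)) = ENNReal.ofReal ((p : ℝ) ^ (4 * j)) := by
  have hp := cast_pos (p := p)
  have hp4 : (p : ENNReal) ^ 4 = ENNReal.ofReal ((p : ℝ) ^ (4 : ℤ)) := by
    rw [← ENNReal.ofReal_natCast, ← ENNReal.ofReal_pow hp.le]
    norm_cast
  induction j using Int.induction_on with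
  | zero =>
    have : Metric.closedBall (0 : V p) 1 = {x : V p | ‖x‖ ≤ 1} := by
      ext
      simp
    simp [this, hμ]
  | succ i ih =>
    rw [measure_closedBall_zpow_add_one, ih, hp4, ← ENNReal.ofReal_mul (by positivity),
      ← zpow_add₀ hp.ne']
    congr 2
    ring
  | pred i ih =>
    have h := measure_closedBall_zpow_add_one μ (-(i : ℤ) - 1)
    rw [sub_add_cancel, ih] at h
    have h2 : ENNReal.ofReal ((p : ℝ) ^ (4 * (-(i : ℤ)))) =
        (p : ENNReal) ^ 4 * ENNReal.ofReal ((p : ℝ) ^ (4 * (-(i : ℤ) - 1))) := by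
      rw [hp4, ← ENNReal.ofReal_mul (by positivity), ← zpow_add₀ hp.ne']
      congr 2
      ring
    rw [h2] at h
    refine ((ENNReal.mul_right_inj ?_ ?_).1 h).symm
    · simp [(Fact.out : p.Prime).ne_zero]
    · finiteness

lemma measure_singleton_zero (hμ : μ {x : V p | ‖x‖ ≤ 1} = 1) : μ {0} = 0 := by
  have hp := cast_pos (p := p)
  refine le_antisymm (ENNReal.le_of_forall_pos_le_add fun ε hε _ => ?_) zero_le
  rw [zero_add]
  obtain ⟨n, hn⟩ := exists_pow_lt_of_lt_one (y := (p : ℝ)⁻¹) (NNReal.coe_pos.2 hε)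
    (inv_lt_one_of_one_lt₀ one_lt_cast)
  calc μ {0} ≤ μ (Metric.closedBall 0 ((p : ℝ) ^ (-(n : ℤ)))) :=
        measure_mono (by simp)
    _ = ENNReal.ofReal ((p : ℝ) ^ (4 * (-(n : ℤ)))) := measure_closedBall_zpow μ hμ _
    _ ≤ ENNReal.ofReal ε := by
        refine ENNReal.ofReal_le_ofReal (le_trans ?_ hn.le)
        rw [inv_pow, ← zpow_natCast, ← zpow_neg]
        exact zpow_le_zpow_right₀ one_lt_cast.le (by omega)
    _ = ε := ENNReal.ofReal_coe_nnreal

lemma continuous_qf (a : ℤ) : Continuous (qf p a) := by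
  unfold qf
  fun_prop

lemma continuous_qfc (a : ℤ) : Continuous (qfc p a) := by
  unfold qfc
  fun_prop

lemma exists_setLIntegral_norm_qf_rpow_le (hμ : μ {x : V p | ‖x‖ ≤ 1} = 1) {a : ℤ}
    (ha : IsQNR p a) {γ : ℝ} (hγ : 0 < γ) :
    ∃ C : ℝ, 0 ≤ C ∧ ∀ j : ℤ,
      ∫⁻ y in {y : V p | (p : ℝ) ^ j < ‖y‖}, ENNReal.ofReal (‖qf p a y‖ ^ (-γ - 2)) ∂μ ≤
        ENNReal.ofReal (C * (p : ℝ) ^ (-2 * γ * j)) := by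
  have hp := cast_pos (p := p)
  have h1 := one_lt_cast (p := p)
  have hsum : Summable fun i : ℕ => ((p : ℝ) ^ (-2 * γ)) ^ i :=
    summable_geometric_of_lt_one (by positivity)
      (Real.rpow_lt_one_of_one_lt_of_neg h1 (by linarith))
  refine ⟨∑' i : ℕ, (p : ℝ) ^ (γ + 6) * ((p : ℝ) ^ (-2 * γ)) ^ i, by positivity, fun j => ?_⟩
  let S : ℕ → Set (V p) := fun i =>
    Metric.closedBall 0 ((p : ℝ) ^ (j + i + 1)) ∩ {y | (p : ℝ) ^ (j + i) < ‖y‖}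
  have hSmeas : ∀ i, MeasurableSet (S i) := fun i =>
    Metric.isClosed_closedBall.measurableSet.inter
      (measurableSet_lt measurable_const measurable_norm)
  have hS : {y : V p | (p : ℝ) ^ j < ‖y‖} ⊆ ⋃ i, S i := by
    intro y hy
    have hy' : (p : ℝ) ^ j < ‖y‖ := hy
    obtain ⟨n, hn1, hn2⟩ := exists_mem_Ioc_zpow (lt_trans (zpow_pos hp j) hy') h1
    have hjn : j < n + 1 := (zpow_lt_zpow_iff_right₀ h1).1 (hy'.trans_le hn2)
    obtain ⟨i, hi⟩ := Int.eq_ofNat_of_zero_le (show 0 ≤ n - j by omega)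
    obtain rfl : n = j + i := by omega
    exact Set.mem_iUnion.2 ⟨i, by simpa using hn2, hn1⟩
  have hK : ∀ i, ∀ y ∈ S i, ENNReal.ofReal (‖qf p a y‖ ^ (-γ - 2)) ≤
      ENNReal.ofReal ((p : ℝ) ^ ((2 * (j + i) - 1) * (-γ - 2))) := by
    intro i y hy
    have hy2 : (p : ℝ) ^ (j + i : ℤ) < ‖y‖ := hy.2
    refine ENNReal.ofReal_le_ofReal ?_
    rw [Real.rpow_mul hp.le]
    refine Real.rpow_le_rpow_of_nonpos (by positivity) ?_ (by linarith)
    have h2 := norm_sq_le_mul_norm_qf ha y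
    rw [Real.rpow_sub_one hp.ne', div_le_iff₀' hp]
    refine le_trans ?_ h2
    have h3 : (p : ℝ) ^ (2 * ((j : ℝ) + i)) = ((p : ℝ) ^ (j + i : ℤ)) ^ 2 := by
      rw [← Real.rpow_intCast, ← Real.rpow_natCast, ← Real.rpow_mul hp.le]
      push_cast
      ring_nf
    rw [h3]
    gcongr
  calc ∫⁻ y in {y : V p | (p : ℝ) ^ j < ‖y‖}, ENNReal.ofReal (‖qf p a y‖ ^ (-γ - 2)) ∂μ
      ≤ ∫⁻ y in ⋃ i, S i, ENNReal.ofReal (‖qf p a y‖ ^ (-γ - 2)) ∂μ := lintegral_mono_set hS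
    _ ≤ ∑' i, ∫⁻ y in S i, ENNReal.ofReal (‖qf p a y‖ ^ (-γ - 2)) ∂μ := lintegral_iUnion_le _ _
    _ ≤ ∑' i : ℕ, ENNReal.ofReal
          (((p : ℝ) ^ (γ + 6) * ((p : ℝ) ^ (-2 * γ)) ^ i) * (p : ℝ) ^ (-2 * γ * j)) := by
        refine ENNReal.tsum_le_tsum fun i => ?_
        calc ∫⁻ y in S i, ENNReal.ofReal (‖qf p a y‖ ^ (-γ - 2)) ∂μ
            ≤ ∫⁻ _ in S i, ENNReal.ofReal ((p : ℝ) ^ ((2 * (j + i) - 1) * (-γ - 2))) ∂μ :=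
              setLIntegral_mono' (hSmeas i) (hK i)
          _ ≤ ENNReal.ofReal ((p : ℝ) ^ ((2 * ((j : ℝ) + i) - 1) * (-γ - 2))) *
                μ (Metric.closedBall 0 ((p : ℝ) ^ (j + i + 1))) := by
              rw [setLIntegral_const]
              gcongr
              exact Set.inter_subset_left
          _ = _ := by
              rw [measure_closedBall_zpow μ hμ, ← ENNReal.ofReal_mul (by positivity)]
              congr 1
              rw [← Real.rpow_intCast, ← Real.rpow_natCast, ← Real.rpow_mul hp.le,
                ← Real.rpow_add hp, ← Real.rpow_add hp, ← Real.rpow_add hp]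
              congr 1
              push_cast
              ring
    _ = _ := by
        rw [← ENNReal.ofReal_tsum_of_nonneg (fun i => by positivity)
          ((hsum.mul_left _).mul_right _), tsum_mul_right]

end Balls

section Coefficients

/-- The value of the symbol `e^{−b |f°|^α}` on the level `|f°| = pⁿ`. -/
def levelValue (b α : ℝ) (n : ℤ) : ℝ := Real.exp (-(b * ((p : ℝ) ^ n) ^ α))

/-- The weight of the set `{|f°| ≤ pⁿ}` in the decomposition of the symbol `e^{−b |f°|^α}`. -/
def levelCoeff (b α : ℝ) (n : ℤ) : ℝ := levelValue p b α n - levelValue p b α (n + 1)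

variable {p} {b α : ℝ}

lemma levelCoeff_nonneg (hb : 0 < b) (hα : 0 < α) (n : ℤ) : 0 ≤ levelCoeff p b α n := by
  have hp := cast_pos (p := p)
  rw [levelCoeff, sub_nonneg, levelValue, levelValue, Real.exp_le_exp, neg_le_neg_iff]
  gcongr
  · exact one_lt_cast.le
  · omega

lemma tendsto_levelValue (hb : 0 < b) (hα : 0 < α) (m : ℤ) :
    Tendsto (fun k : ℕ => levelValue p b α (m + k)) atTop (nhds 0) := by
  have hp := cast_pos (p := p)
  have h1 : Tendsto (fun k : ℕ => (p : ℝ) ^ (m + k : ℤ)) atTop atTop := by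
    have : (fun k : ℕ => (p : ℝ) ^ (m + k : ℤ)) = fun k : ℕ => (p : ℝ) ^ m * (p : ℝ) ^ k := by
      funext k
      rw [zpow_add₀ hp.ne', zpow_natCast]
    rw [this]
    exact (tendsto_pow_atTop_atTop_of_one_lt one_lt_cast).const_mul_atTop (by positivity)
  exact Real.tendsto_exp_neg_atTop_nhds_zero.comp
    (((tendsto_rpow_atTop hα).comp h1).const_mul_atTop hb)

lemma hasSum_levelCoeff (hb : 0 < b) (hα : 0 < α) (m : ℤ) :
    HasSum (fun n : ℤ => if m ≤ n then levelCoeff p b α n else 0) (levelValue p b α m) := by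
  have hinj : Function.Injective fun k : ℕ => m + (k : ℤ) := fun k l h => by simpa using h
  rw [← hinj.hasSum_iff]
  · have h : ((fun n : ℤ => if m ≤ n then levelCoeff p b α n else 0) ∘ fun k : ℕ => m + (k : ℤ)) =
        fun k : ℕ => levelValue p b α (m + k) - levelValue p b α (m + (k + 1 : ℕ)) := by
      funext k
      simp [levelCoeff, add_assoc]
    rw [h, hasSum_iff_tendsto_nat_of_nonneg]
    · simp only [Finset.sum_range_sub' fun k : ℕ => levelValue p b α (m + k)]
      simpa using (tendsto_levelValue (p := p) hb hα m).const_sub (levelValue p b α m)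
    · intro k
      simpa [levelCoeff, add_assoc] using levelCoeff_nonneg (p := p) hb hα (m + k)
  · intro n hn
    refine if_neg fun h => hn ⟨(n - m).toNat, ?_⟩
    simp only
    omega

lemma summable_levelCoeff_mul_rpow (hb : 0 < b) (hα : 0 < α) {s : ℝ} (hs : 0 < s) :
    Summable fun n : ℤ => levelCoeff p b α n * (p : ℝ) ^ (s * n) := by
  have hp := cast_pos (p := p)
  have h1 := one_lt_cast (p := p)
  refine Summable.of_nat_of_neg ?_ ?_
  · obtain ⟨N, hN⟩ := exists_nat_ge ((s + 1) / α)
    rw [div_le_iff₀ hα] at hN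
    refine Summable.of_nonneg_of_le
      (fun n => mul_nonneg (levelCoeff_nonneg hb hα _) (by positivity)) (fun n => ?_)
      ((summable_geometric_of_lt_one (by positivity)
        (inv_lt_one_of_one_lt₀ h1)).mul_left (N.factorial / b ^ N : ℝ))
    have hu : (0 : ℝ) < ((p : ℝ) ^ (n : ℤ)) ^ α := by positivity
    have hexp := Real.pow_div_factorial_le_exp (b * ((p : ℝ) ^ (n : ℤ)) ^ α) (by positivity) N
    have hc : levelCoeff p b α n ≤ N.factorial / (b * ((p : ℝ) ^ (n : ℤ)) ^ α) ^ N := by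
      refine (sub_le_self _ (Real.exp_pos _).le).trans ?_
      rw [levelValue, Real.exp_neg]
      refine (inv_anti₀ (by positivity) hexp).trans_eq ?_
      rw [inv_div]
    calc levelCoeff p b α n * (p : ℝ) ^ (s * (n : ℤ))
        ≤ N.factorial / (b * ((p : ℝ) ^ (n : ℤ)) ^ α) ^ N * (p : ℝ) ^ (s * (n : ℤ)) := by gcongr
      _ = N.factorial / b ^ N * (p : ℝ) ^ ((s - N * α) * n) := by
          have : (((p : ℝ) ^ (n : ℤ)) ^ α) ^ N = (p : ℝ) ^ (N * α * n) := by
            rw [← Real.rpow_intCast, ← Real.rpow_natCast, ← Real.rpow_mul hp.le,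
              ← Real.rpow_mul hp.le]
            push_cast
            ring_nf
          rw [mul_pow, this, sub_mul, Real.rpow_sub hp]
          push_cast
          field_simp
      _ ≤ N.factorial / b ^ N * (p : ℝ)⁻¹ ^ n := by
          rw [← Real.rpow_neg_one, ← Real.rpow_natCast ((p : ℝ) ^ (-1 : ℝ)), ← Real.rpow_mul hp.le]
          gcongr
          · exact h1.le
          · linarith
  · refine Summable.of_nonneg_of_le
      (fun n => mul_nonneg (levelCoeff_nonneg hb hα _) (by positivity)) (fun n => ?_)
      (summable_geometric_of_lt_one (r := (p : ℝ) ^ (-s)) (by positivity)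
        (Real.rpow_lt_one_of_one_lt_of_neg h1 (by linarith)))
    have hc : levelCoeff p b α (-n) ≤ 1 := by
      refine (sub_le_self _ (Real.exp_pos _).le).trans ?_
      rw [levelValue, Real.exp_le_one_iff, neg_nonpos]
      positivity
    refine (mul_le_of_le_one_left (by positivity) hc).trans_eq ?_
    rw [← Real.rpow_natCast, ← Real.rpow_mul hp.le]
    push_cast
    ring_nf

end Coefficients

section LevelSets

/-- The set `{|f°| ≤ pⁿ}`. -/
def levelSet (a : ℤ) (n : ℤ) : Set (V p) := {ξ | ‖qfc p a ξ‖ ≤ (p : ℝ) ^ n}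

/-- The Fourier transform of the indicator function of `{|f°| ≤ pⁿ}`. -/
def levelKernel (μ : Measure (V p)) (χ : ℚ_[p] → ℂ) (a : ℤ) (n : ℤ) (x : V p) : ℂ :=
  ∫ ξ in levelSet p a n, χ (∑ i, ξ i * x i) ∂μ

variable {p} {a : ℤ}

lemma measurableSet_levelSet (n : ℤ) : MeasurableSet (levelSet p a n) :=
  (isClosed_le (continuous_qfc a).norm continuous_const).measurableSet

lemma levelSet_subset_closedBall (ha : IsQNR p a) (n : ℤ) :
    levelSet p a n ⊆ Metric.closedBall 0 ((p : ℝ) ^ (n / 2 + 1)) := by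
  have hp := cast_pos (p := p)
  intro ξ hξ
  rw [mem_closedBall_zero_iff]
  refine (sq_le_sq₀ (norm_nonneg _) (by positivity)).1 ?_
  calc ‖ξ‖ ^ 2 ≤ p * ‖qfc p a ξ‖ := norm_sq_le_mul_norm_qfc ha ξ
    _ ≤ p * (p : ℝ) ^ n := by gcongr; exact hξ
    _ = (p : ℝ) ^ (n + 1) := by rw [zpow_add_one₀ hp.ne', mul_comm]
    _ ≤ (p : ℝ) ^ ((n / 2 + 1) * 2) := zpow_le_zpow_right₀ one_lt_cast.le (by omega)
    _ = _ := by rw [zpow_mul]; norm_cast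

lemma add_mem_levelSet_iff (ha : IsQNR p a) {n : ℤ} {η : V p} (hη : ‖η‖ ≤ (p : ℝ) ^ (n / 2))
    (ξ : V p) : ξ + η ∈ levelSet p a n ↔ ξ ∈ levelSet p a n := by
  have hp := cast_pos (p := p)
  have hmem : ∀ η : V p, ‖η‖ ≤ (p : ℝ) ^ (n / 2) → ‖qfc p a η‖ ≤ (p : ℝ) ^ n := fun η hη => by
    calc ‖qfc p a η‖ ≤ ‖η‖ ^ 2 := norm_qfc_le_norm_sq ha η
      _ ≤ ((p : ℝ) ^ (n / 2)) ^ 2 := by gcongr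
      _ = (p : ℝ) ^ (n / 2 * 2) := by rw [zpow_mul]; norm_cast
      _ ≤ (p : ℝ) ^ n := zpow_le_zpow_right₀ one_lt_cast.le (by omega)
  refine ⟨fun h => ?_, fun h => (norm_qfc_add_le ha ξ η).trans (max_le h (hmem η hη))⟩
  have := (norm_qfc_add_le ha (ξ + η) (-η)).trans (max_le h (hmem (-η) (by rwa [norm_neg])))
  rwa [add_neg_cancel_right] at this

variable {μ : Measure (V p)}

lemma measure_levelSet_le [μ.IsAddHaarMeasure] (hμ : μ {x : V p | ‖x‖ ≤ 1} = 1) (ha : IsQNR p a) (n : ℤ) :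
    μ (levelSet p a n) ≤ ENNReal.ofReal ((p : ℝ) ^ (4 * (n / 2 + 1))) :=
  (measure_mono (levelSet_subset_closedBall ha n)).trans_eq (measure_closedBall_zpow μ hμ _)

variable {χ : ℚ_[p] → ℂ}

lemma enorm_levelKernel_le (hχ : IsStdChar p χ) (n : ℤ) (x : V p) :
    ‖levelKernel p μ χ a n x‖ₑ ≤ μ (levelSet p a n) := by
  refine (enorm_integral_le_lintegral_enorm _).trans_eq ?_
  simp [← ofReal_norm, hχ.norm_eq_one]

lemma levelKernel_eq_zero [μ.IsAddHaarMeasure] (ha : IsQNR p a) (hχ : IsStdChar p χ) {n : ℤ} {x : V p}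
    (hx : (p : ℝ) ^ (-(n / 2)) < ‖x‖) : levelKernel p μ χ a n x = 0 := by
  have hp := cast_pos (p := p)
  have hpq : (p : ℚ_[p]) ≠ 0 := by exact_mod_cast (Fact.out : p.Prime).ne_zero
  obtain ⟨i, hi⟩ : ∃ i, (p : ℝ) ^ (-(n / 2)) < ‖x i‖ := by
    by_contra! h
    exact hx.not_ge ((pi_norm_le_iff_of_nonneg (by positivity)).2 h)
  have hxi : x i ≠ 0 := by
    rintro h0
    rw [h0, norm_zero] at hi
    exact hi.not_ge (by positivity)
  have hi' : (p : ℝ) ^ (-(n / 2) + 1) ≤ ‖x i‖ := by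
    rw [Padic.norm_eq_zpow_neg_valuation hxi] at hi ⊢
    have := (zpow_lt_zpow_iff_right₀ (one_lt_cast (p := p))).1 hi
    exact zpow_le_zpow_right₀ one_lt_cast.le (by omega)
  let η : V p := Pi.single i ((p : ℚ_[p])⁻¹ * (x i)⁻¹)
  have hη : ‖η‖ ≤ (p : ℝ) ^ (n / 2) := by
    rw [Pi.norm_single, norm_mul, norm_inv, norm_inv, Padic.norm_p, inv_inv,
      ← div_eq_mul_inv, div_le_iff₀ (norm_pos_iff.2 hxi)]
    calc (p : ℝ) = (p : ℝ) ^ (n / 2) * (p : ℝ) ^ (-(n / 2) + 1) := by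
          rw [← zpow_add₀ hp.ne']
          simp
      _ ≤ _ := by gcongr
  have hηx : ∑ j, η j * x j = (p : ℚ_[p])⁻¹ := by
    rw [Finset.sum_eq_single i (fun j _ hj => by simp [η, hj]) (by simp)]
    simp [η, hxi]
  have hinv : levelKernel p μ χ a n x = levelKernel p μ χ a n x * χ (p : ℚ_[p])⁻¹ := by
    conv_lhs =>
      rw [levelKernel, ← integral_indicator (measurableSet_levelSet n),
        ← integral_add_right_eq_self _ η]
    rw [levelKernel, ← integral_mul_const, ← integral_indicator (measurableSet_levelSet n)]
    congr 1
    funext ξ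
    by_cases hξ : ξ ∈ levelSet p a n
    · rw [Set.indicator_of_mem ((add_mem_levelSet_iff ha hη ξ).2 hξ), Set.indicator_of_mem hξ,
        ← hχ.map_add, ← hηx, ← Finset.sum_add_distrib]
      simp only [Pi.add_apply, add_mul]
    · rw [Set.indicator_of_notMem (mt (add_mem_levelSet_iff ha hη ξ).1 hξ),
        Set.indicator_of_notMem hξ]
  by_contra hne
  exact hχ.inv_prime_ne_one (mul_left_cancel₀ hne (by rw [← hinv, mul_one]))

lemma levelKernel_sub_of_norm_le (ha : IsQNR p a) (hχ : IsStdChar p χ) {n : ℤ} {y : V p}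
    (hy : ‖y‖ ≤ (p : ℝ) ^ (-(n / 2 + 1))) (x : V p) :
    levelKernel p μ χ a n (x - y) = levelKernel p μ χ a n x := by
  have hp := cast_pos (p := p)
  refine setIntegral_congr_fun (measurableSet_levelSet n) fun ξ hξ => ?_
  have hξ' := mem_closedBall_zero_iff.1 (levelSet_subset_closedBall ha n hξ)
  have h1 : ‖∑ i, ξ i * y i‖ ≤ 1 := by
    refine IsUltrametricDist.norm_sum_le_of_forall_le_of_nonneg zero_le_one fun i _ => ?_
    rw [norm_mul]
    calc ‖ξ i‖ * ‖y i‖ ≤ (p : ℝ) ^ (n / 2 + 1) * (p : ℝ) ^ (-(n / 2 + 1)) := by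
          gcongr
          · exact (norm_le_pi_norm ξ i).trans hξ'
          · exact (norm_le_pi_norm y i).trans hy
      _ = 1 := by
          rw [← zpow_add₀ hp.ne']
          simp
  have h2 : ∑ i, ξ i * x i = ∑ i, ξ i * (x - y) i + ∑ i, ξ i * y i := by
    rw [← Finset.sum_add_distrib]
    simp [mul_sub]
  rw [h2, hχ.map_add, hχ.eq_one_of_norm_le_one h1, mul_one]

lemma continuous_levelKernel (ha : IsQNR p a) (hχ : IsStdChar p χ) (n : ℤ) :
    Continuous (levelKernel p μ χ a n) := by
  have hp := cast_pos (p := p)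
  refine IsLocallyConstant.continuous ((IsLocallyConstant.iff_eventually_eq _).2 fun x => ?_)
  filter_upwards [Metric.closedBall_mem_nhds x (zpow_pos hp (-(n / 2 + 1)))] with z hz
  rw [← levelKernel_sub_of_norm_le (y := x - z) ha hχ (by rwa [← dist_eq_norm, dist_comm]) x,
    sub_sub_cancel]

lemma lintegral_enorm_levelKernel_le [μ.IsAddHaarMeasure] (hμ : μ {x : V p | ‖x‖ ≤ 1} = 1) (ha : IsQNR p a)
    (hχ : IsStdChar p χ) (n : ℤ) :
    ∫⁻ x, ‖levelKernel p μ χ a n x‖ₑ ∂μ ≤ ENNReal.ofReal ((p : ℝ) ^ 4) := by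
  have hp := cast_pos (p := p)
  have hB : MeasurableSet (Metric.closedBall (0 : V p) ((p : ℝ) ^ (-(n / 2)))) :=
    Metric.isClosed_closedBall.measurableSet
  calc ∫⁻ x, ‖levelKernel p μ χ a n x‖ₑ ∂μ
      ≤ ∫⁻ x, (Metric.closedBall (0 : V p) ((p : ℝ) ^ (-(n / 2)))).indicator
          (fun _ => ENNReal.ofReal ((p : ℝ) ^ (4 * (n / 2 + 1)))) x ∂μ := by
        refine lintegral_mono fun x => ?_
        by_cases hx : x ∈ Metric.closedBall (0 : V p) ((p : ℝ) ^ (-(n / 2)))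
        · rw [Set.indicator_of_mem hx]
          exact (enorm_levelKernel_le hχ n x).trans (measure_levelSet_le hμ ha n)
        · rw [levelKernel_eq_zero ha hχ (by simpa using hx)]
          simp
    _ = ENNReal.ofReal ((p : ℝ) ^ 4) := by
        rw [lintegral_indicator_const hB, measure_closedBall_zpow μ hμ,
          ← ENNReal.ofReal_mul (by positivity), ← zpow_add₀ hp.ne', ← zpow_natCast]
        congr 2
        push_cast
        ring

lemma integrable_levelKernel [μ.IsAddHaarMeasure] (hμ : μ {x : V p | ‖x‖ ≤ 1} = 1) (ha : IsQNR p a)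
    (hχ : IsStdChar p χ) (n : ℤ) : Integrable (levelKernel p μ χ a n) μ :=
  ⟨(continuous_levelKernel ha hχ n).aestronglyMeasurable,
    (lintegral_enorm_levelKernel_le hμ ha hχ n).trans_lt ENNReal.ofReal_lt_top⟩

end LevelSets

section HeatKernel

variable {p} {a : ℤ} {μ : Measure (V p)} {χ : ℚ_[p] → ℂ} {κ α t : ℝ}

lemma hasSum_levelCoeff_mul_indicator (ha : IsQNR p a) (hα : 0 < α) {b : ℝ} (hb : 0 < b)
    {ξ : V p} (hξ : ξ ≠ 0) (z : ℂ) :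
    HasSum (fun n : ℤ => (levelCoeff p b α n : ℂ) * (levelSet p a n).indicator (fun _ => z) ξ)
      (z * (Real.exp (-(b * ‖qfc p a ξ‖ ^ α)) : ℂ)) := by
  have hq : qfc p a ξ ≠ 0 := by
    intro h0
    have h := norm_sq_le_mul_norm_qfc ha ξ
    rw [h0, norm_zero, mul_zero] at h
    have := norm_pos_iff.2 hξ
    nlinarith
  have hm := Padic.norm_eq_zpow_neg_valuation hq
  have h := (Complex.hasSum_ofReal.2
    (hasSum_levelCoeff (p := p) hb hα (-(qfc p a ξ).valuation))).mul_left z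
  rw [levelValue, ← hm] at h
  refine h.congr_fun fun n => ?_
  have hiff : ξ ∈ levelSet p a n ↔ -(qfc p a ξ).valuation ≤ n := by
    rw [levelSet, Set.mem_ofPred_eq, hm, zpow_le_zpow_iff_right₀ one_lt_cast]
  by_cases hn : -(qfc p a ξ).valuation ≤ n
  · rw [if_pos hn, Set.indicator_of_mem (hiff.2 hn), mul_comm]
  · rw [if_neg hn, Set.indicator_of_notMem (mt hiff.1 hn)]
    simp

lemma hasSum_heatZ [μ.IsAddHaarMeasure]
    (hμ : μ {x : V p | ‖x‖ ≤ 1} = 1) (ha : IsQNR p a) (hχ : IsStdChar p χ)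
    (hκ : 0 < κ) (hα : 0 < α) (ht : 0 < t) (x : V p) :
    HasSum (fun n : ℤ => (levelCoeff p (κ * t) α n : ℂ) * levelKernel p μ χ a n x)
      (heatZ p μ χ a κ α x t) := by
  have hp := cast_pos (p := p)
  have hb : 0 < κ * t := mul_pos hκ ht
  have hχc := hχ.1
  let G : V p → ℂ := fun ξ => χ (∑ i, ξ i * x i)
  have hG : Continuous G := by fun_prop
  have hfin : ∀ n, μ (levelSet p a n) ≠ ⊤ := fun n =>
    ((measure_levelSet_le hμ ha n).trans_lt ENNReal.ofReal_lt_top).ne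
  let F : ℤ → V p → ℂ := fun n ξ =>
    (levelCoeff p (κ * t) α n : ℂ) * (levelSet p a n).indicator G ξ
  have hFint : ∀ n, Integrable (F n) μ := fun n => by
    refine ((integrable_indicator_iff (measurableSet_levelSet n)).2 ?_).const_mul _
    exact Measure.integrableOn_of_bounded (hfin n) hG.aestronglyMeasurable
      (M := 1) (Eventually.of_forall fun ξ => (hχ.norm_eq_one _).le)
  have hFnorm : ∀ n, ∫ ξ, ‖F n ξ‖ ∂μ = levelCoeff p (κ * t) α n * μ.real (levelSet p a n) := by
    intro n
    have h : ∀ ξ, ‖F n ξ‖ = levelCoeff p (κ * t) α n * (levelSet p a n).indicator 1 ξ := by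
      intro ξ
      rw [norm_mul, Complex.norm_real, Real.norm_of_nonneg (levelCoeff_nonneg hb hα n),
        norm_indicator_eq_indicator_norm]
      by_cases hξ : ξ ∈ levelSet p a n <;> simp [hξ, G, hχ.norm_eq_one]
    simp_rw [h]
    rw [integral_const_mul, integral_indicator_one (measurableSet_levelSet n)]
  have hsum : Summable fun n => ∫ ξ, ‖F n ξ‖ ∂μ := by
    refine Summable.of_nonneg_of_le (fun n => by positivity) (fun n => ?_)
      ((summable_levelCoeff_mul_rpow (p := p) hb hα two_pos).mul_right ((p : ℝ) ^ (4 : ℝ)))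
    rw [hFnorm, mul_assoc, ← Real.rpow_add hp]
    refine mul_le_mul_of_nonneg_left ?_ (levelCoeff_nonneg hb hα n)
    refine (ENNReal.toReal_le_of_le_ofReal (by positivity) (measure_levelSet_le hμ ha n)).trans ?_
    rw [← Real.rpow_intCast]
    refine Real.rpow_le_rpow_of_exponent_le one_lt_cast.le ?_
    have : 4 * (n / 2 + 1) ≤ 2 * n + 4 := by omega
    exact_mod_cast this
  have h := hasSum_integral_of_summable_integral_norm hFint hsum
  have hZ : ∫ ξ, ∑' n, F n ξ ∂μ = heatZ p μ χ a κ α x t := by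
    refine integral_congr_ae ?_
    filter_upwards [compl_mem_ae_iff.2 (measure_singleton_zero μ hμ)] with ξ hξ
    refine Eq.trans ?_ (hasSum_levelCoeff_mul_indicator ha hα hb hξ (G ξ)).tsum_eq
    refine tsum_congr fun n => ?_
    by_cases hn : ξ ∈ levelSet p a n <;> simp [F, hn]
  rw [hZ] at h
  refine h.congr_fun fun n => ?_
  simp only [F]
  rw [integral_const_mul, integral_indicator (measurableSet_levelSet n)]
  rfl

/-- The contribution of the level `{|f°| ≤ pⁿ}` to `(Z_t(x − y) − Z_t(x)) |f(y)|^{−γ−2}`. -/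
def levelDifference (μ : Measure (V p)) (χ : ℚ_[p] → ℂ) (a : ℤ) (γ : ℝ) (n : ℤ)
    (z : V p × V p) : ℂ :=
  (levelKernel p μ χ a n (z.1 - z.2) - levelKernel p μ χ a n z.1) *
    ((‖qf p a z.2‖ ^ (-γ - 2) : ℝ) : ℂ)

variable {γ : ℝ}

lemma measurable_levelDifference (ha : IsQNR p a) (hχ : IsStdChar p χ) (n : ℤ) :
    Measurable (levelDifference μ χ a γ n) := by
  have h1 := continuous_levelKernel (μ := μ) ha hχ n
  have h2 : Measurable (qf p a) := (continuous_qf a).measurable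
  unfold levelDifference
  refine Measurable.mul ?_ ?_
  · exact Continuous.measurable (by fun_prop)
  · fun_prop

lemma lintegral_enorm_levelDifference_left_le [μ.IsAddHaarMeasure]
    (hμ : μ {x : V p | ‖x‖ ≤ 1} = 1) (ha : IsQNR p a)
    (hχ : IsStdChar p χ) (n : ℤ) (y : V p) :
    ∫⁻ x, ‖levelDifference μ χ a γ n (x, y)‖ₑ ∂μ ≤
      {y : V p | (p : ℝ) ^ (-(n / 2 + 1)) < ‖y‖}.indicator
        (fun y => ENNReal.ofReal (2 * (p : ℝ) ^ 4) * ENNReal.ofReal (‖qf p a y‖ ^ (-γ - 2))) y := by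
  by_cases hy : (p : ℝ) ^ (-(n / 2 + 1)) < ‖y‖
  · rw [Set.indicator_of_mem (by exact hy)]
    have hc := continuous_levelKernel (μ := μ) ha hχ n
    have hK : ∀ x, ‖levelDifference μ χ a γ n (x, y)‖ₑ =
        ‖levelKernel p μ χ a n (x - y) - levelKernel p μ χ a n x‖ₑ *
          ENNReal.ofReal (‖qf p a y‖ ^ (-γ - 2)) := fun x => by
      rw [levelDifference, enorm_mul, ← ofReal_norm ((‖qf p a y‖ ^ (-γ - 2) : ℝ) : ℂ),
        Complex.norm_real, Real.norm_of_nonneg (by positivity)]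
    simp_rw [hK]
    rw [lintegral_mul_const' _ _ ENNReal.ofReal_ne_top]
    gcongr
    calc ∫⁻ x, ‖levelKernel p μ χ a n (x - y) - levelKernel p μ χ a n x‖ₑ ∂μ
        ≤ ∫⁻ x, (‖levelKernel p μ χ a n (x - y)‖ₑ + ‖levelKernel p μ χ a n x‖ₑ) ∂μ :=
          lintegral_mono fun x => enorm_sub_le
      _ = 2 * ∫⁻ x, ‖levelKernel p μ χ a n x‖ₑ ∂μ := by
          rw [lintegral_add_right _ hc.measurable.enorm,
            lintegral_sub_right_eq_self (fun x => ‖levelKernel p μ χ a n x‖ₑ) y, two_mul]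
      _ ≤ 2 * ENNReal.ofReal ((p : ℝ) ^ 4) := by
          gcongr
          exact lintegral_enorm_levelKernel_le hμ ha hχ n
      _ = _ := by
          rw [ENNReal.ofReal_mul two_pos.le]
          simp
  · rw [Set.indicator_of_notMem (by exact hy)]
    simp [levelDifference, levelKernel_sub_of_norm_le ha hχ (not_lt.1 hy)]

lemma exists_lintegral_enorm_levelDifference_le [μ.IsAddHaarMeasure]
    (hμ : μ {x : V p | ‖x‖ ≤ 1} = 1)
    (ha : IsQNR p a) (hχ : IsStdChar p χ) (hγ : 0 < γ) :
    ∃ C : ℝ, 0 ≤ C ∧ ∀ n : ℤ,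
      ∫⁻ z, ‖levelDifference μ χ a γ n z‖ₑ ∂(μ.prod μ) ≤ ENNReal.ofReal (C * (p : ℝ) ^ (γ * n)) := by
  have hp := cast_pos (p := p)
  obtain ⟨C, hC, hCj⟩ := exists_setLIntegral_norm_qf_rpow_le μ hμ ha hγ
  refine ⟨2 * (p : ℝ) ^ 4 * (C * (p : ℝ) ^ (2 * γ)), by positivity, fun n => ?_⟩
  rw [lintegral_prod_symm' _ (measurable_levelDifference ha hχ n).enorm]
  calc _ ≤ ∫⁻ y, {y : V p | (p : ℝ) ^ (-(n / 2 + 1)) < ‖y‖}.indicator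
        (fun y => ENNReal.ofReal (2 * (p : ℝ) ^ 4) * ENNReal.ofReal (‖qf p a y‖ ^ (-γ - 2))) y ∂μ :=
        lintegral_mono fun y => lintegral_enorm_levelDifference_left_le hμ ha hχ n y
    _ = ENNReal.ofReal (2 * (p : ℝ) ^ 4) * ∫⁻ y in {y : V p | (p : ℝ) ^ (-(n / 2 + 1)) < ‖y‖},
          ENNReal.ofReal (‖qf p a y‖ ^ (-γ - 2)) ∂μ := by
        rw [lintegral_indicator (measurableSet_lt measurable_const measurable_norm),
          lintegral_const_mul' _ _ ENNReal.ofReal_ne_top]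
    _ ≤ ENNReal.ofReal (2 * (p : ℝ) ^ 4) *
          ENNReal.ofReal (C * (p : ℝ) ^ (-2 * γ * (-(n / 2 + 1) : ℤ))) := by
        gcongr
        exact hCj _
    _ ≤ _ := by
        rw [← ENNReal.ofReal_mul (by positivity)]
        refine ENNReal.ofReal_le_ofReal ?_
        rw [mul_assoc (2 * (p : ℝ) ^ 4), mul_assoc C, ← Real.rpow_add hp]
        gcongr
        · exact one_lt_cast.le
        · have h : 2 * (n / 2 + 1) ≤ n + 2 := by omega
          have h' : (2 : ℝ) * ((n / 2 : ℤ) + 1) ≤ n + 2 := by exact_mod_cast h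
          push_cast
          nlinarith

lemma integral_levelDifference [μ.IsAddHaarMeasure]
    (hμ : μ {x : V p | ‖x‖ ≤ 1} = 1)
    (ha : IsQNR p a) (hχ : IsStdChar p χ) (n : ℤ)
    (hint : Integrable (levelDifference μ χ a γ n) (μ.prod μ)) :
    ∫ z, levelDifference μ χ a γ n z ∂(μ.prod μ) = 0 := by
  have hD := integrable_levelKernel hμ ha hχ n
  rw [integral_prod_symm _ hint]
  simp only [levelDifference]
  simp_rw [integral_mul_const]
  have h : ∀ y, ∫ x, (levelKernel p μ χ a n (x - y) - levelKernel p μ χ a n x) ∂μ = 0 := fun y => by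
    rw [integral_sub (hD.comp_sub_right y) hD, integral_sub_right_eq_self, sub_self]
  simp [h]

lemma hasSum_levelDifference [μ.IsAddHaarMeasure]
    (hμ : μ {x : V p | ‖x‖ ≤ 1} = 1) (ha : IsQNR p a)
    (hχ : IsStdChar p χ) (hκ : 0 < κ) (hα : 0 < α) (ht : 0 < t) (z : V p × V p) :
    HasSum (fun n : ℤ => (levelCoeff p (κ * t) α n : ℂ) * levelDifference μ χ a γ n z)
      ((heatZ p μ χ a κ α (z.1 - z.2) t - heatZ p μ χ a κ α z.1 t) *
        ((‖qf p a z.2‖ ^ (-γ - 2) : ℝ) : ℂ)) := by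
  refine (((hasSum_heatZ hμ ha hχ hκ hα ht (z.1 - z.2)).sub
    (hasSum_heatZ hμ ha hχ hκ hα ht z.1)).mul_right _).congr_fun fun n => ?_
  rw [levelDifference]
  ring

end HeatKernel

/-- for `0 < γ ≤ α` and every `t > 0`, `∫ (f(∂,γ)Z_t)(x) d⁴x = 0`. -/
theorem statement12
    (hp : p ≠ 2) (a : ℤ) (ha : IsQNR p a)
    (μ : Measure (V p)) [μ.IsAddHaarMeasure] (hμ : μ {x : V p | ‖x‖ ≤ 1} = 1)
    (χ : ℚ_[p] → ℂ) (hχ : IsStdChar p χ)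
    (κ α γ : ℝ) (hκ : 0 < κ) (hα : 0 < α) (hγ : 0 < γ) (hγα : γ ≤ α)
    (t : ℝ) (ht : 0 < t) :
    (∫ x, fop p μ a γ (fun y => heatZ p μ χ a κ α y t) x ∂μ) = 0 := by
  have hb : 0 < κ * t := mul_pos hκ ht
  obtain ⟨C, hC, hCn⟩ := exists_lintegral_enorm_levelDifference_le hμ ha hχ hγ
  let F : ℤ → V p × V p → ℂ := fun n z =>
    (levelCoeff p (κ * t) α n : ℂ) * levelDifference μ χ a γ n z
  let H : V p × V p → ℂ := fun z =>
    (heatZ p μ χ a κ α (z.1 - z.2) t - heatZ p μ χ a κ α z.1 t) *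
      ((‖qf p a z.2‖ ^ (-γ - 2) : ℝ) : ℂ)
  have hH : ∀ z, HasSum (fun n => F n z) (H z) := hasSum_levelDifference hμ ha hχ hκ hα ht
  have hL : ∀ n, Integrable (levelDifference μ χ a γ n) (μ.prod μ) := fun n =>
    ⟨(measurable_levelDifference ha hχ n).aestronglyMeasurable,
      (hCn n).trans_lt ENNReal.ofReal_lt_top⟩
  have hFm : ∀ n, AEStronglyMeasurable (F n) (μ.prod μ) := fun n => ((hL n).const_mul _).1
  have hFsum : ∑' n, ∫⁻ z, ‖F n z‖ₑ ∂(μ.prod μ) ≠ ⊤ := by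
    have hle : ∀ n, ∫⁻ z, ‖F n z‖ₑ ∂(μ.prod μ) ≤
        ENNReal.ofReal (levelCoeff p (κ * t) α n * (p : ℝ) ^ (γ * n) * C) := fun n => by
      have hc := levelCoeff_nonneg (p := p) hb hα n
      simp only [F, enorm_mul]
      rw [lintegral_const_mul' _ _ enorm_ne_top, ← ofReal_norm (levelCoeff p (κ * t) α n : ℂ),
        Complex.norm_real, Real.norm_of_nonneg hc, mul_assoc, ENNReal.ofReal_mul hc, mul_comm _ C]
      gcongr
      exact hCn n
    refine ne_top_of_le_ne_top ?_ (ENNReal.tsum_le_tsum hle)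
    exact ((summable_levelCoeff_mul_rpow hb hα hγ).mul_right C).tsum_ofReal_ne_top
  have hHint : Integrable H (μ.prod μ) := by
    refine ⟨?_, ?_⟩
    · exact aestronglyMeasurable_of_tendsto_ae atTop
        (f := fun (s : Finset ℤ) z => ∑ n ∈ s, F n z)
        (fun s => s.aestronglyMeasurable_fun_sum fun n _ => hFm n) (Eventually.of_forall hH)
    · refine lt_of_le_of_lt (lintegral_mono fun z => ?_) (lt_top_iff_ne_top.2 hFsum
        |> (lintegral_tsum fun n => (hFm n).enorm).trans_lt)
      rw [← (hH z).tsum_eq]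
      exact enorm_tsum_le_tsum_enorm
  have hzero : ∫ z, H z ∂(μ.prod μ) = 0 := by
    simp_rw [← fun z => (hH z).tsum_eq]
    rw [integral_tsum hFm hFsum]
    simp only [F, integral_const_mul, integral_levelDifference hμ ha hχ _ (hL _), mul_zero,
      tsum_zero]
  rw [integral_prod _ hHint] at hzero
  simp only [fop, integral_const_mul]
  exact mul_eq_zero_of_right _ hzero

end PadicParabolic
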